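/- arXiv:2008.02447 — 5 statements merged into one kernel-verified Lean document; each statement's English description precedes it below -/
import Mathlib

section
/- Let X, Y, Φ be measurable spaces, D a probability measure on X × Y with marginal D_X on X, and let H (measurable representation functions X → Φ), F (prediction functions Φ → Y) and G (regularization indices) be finite nonempty classes, with all required maps measurable. Suppose there exist h* ∈ H, f* ∈ F, g* ∈ G such that L_c(f*, h*; D) = 0 and L_r(h*, g*; D_X) = 0. Let ε₀, ε₁ ∈ (0, 1/2), δ ∈ (0, 1), and let m_u, m_l be positive integers with m_u ≥ (1/ε₀)(ln|G| + ln|H| + ln(2/δ)) and m_l ≥ (1/ε₁)(ln|F| + ln|H_{D_X,L_r}(ε₀)| + ln(2/δ)). Then with probability at least 1 − δ over an i.i.d. sample U of m_u points from D_X and an independent i.i.d. sample S of m_l points from D, every pair (f, h) ∈ F × H with L_c(f, h; S) = 0 and L_r(h; U) = 0 satisfies L_c(f, h; D) ≤ ε₁. -/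
open MeasureTheory

/-- If a `[0, 1]`-valued function has mean larger than `ε`, then all of its values on an i.i.d. sample
of size `m` vanish with probability at most `exp (-ε m)`. -/
lemma measure_pi_sum_eq_zero_le {Ω : Type*} [MeasurableSpace Ω] (μ : Measure Ω)
    [IsProbabilityMeasure μ] {φ : Ω → ℝ} (hφ : Measurable φ)
    (hφ01 : ∀ x, φ x ∈ Set.Icc (0 : ℝ) 1) {ε : ℝ} (hε : ε < ∫ x, φ x ∂μ) (m : ℕ) :
    (Measure.pi fun _ : Fin m => μ) {s | ∑ k, φ (s k) = 0} ≤
      ENNReal.ofReal (Real.exp (-(ε * m))) := by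
  have hset : {s : Fin m → Ω | ∑ k, φ (s k) = 0} = Set.univ.pi fun _ => {x | φ x = 0} := by
    ext s
    simp [Finset.sum_eq_zero_iff_of_nonneg fun k _ => (hφ01 (s k)).1]
  have hzero : MeasurableSet {x | φ x = 0} := hφ (measurableSet_singleton 0)
  have hmean : ∫ x, φ x ∂μ ≤ μ.real {x | φ x = 0}ᶜ := by
    rw [← integral_indicator_one hzero.compl]
    refine integral_mono_of_nonneg (.of_forall fun x => (hφ01 x).1)
      ((integrable_const 1).indicator hzero.compl) (.of_forall fun x => ?_)
    by_cases hx : φ x = 0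
    · simp [hx]
    · simpa [Set.indicator, hx] using (hφ01 x).2
  have hμ : μ.real {x | φ x = 0} ≤ Real.exp (-ε) := by
    rw [probReal_compl_eq_one_sub hzero] at hmean
    linarith [Real.add_one_le_exp (-ε)]
  rw [hset, Measure.pi_pi, Finset.prod_const, Finset.card_univ, Fintype.card_fin,
    ← ofReal_measureReal, ← ENNReal.ofReal_pow measureReal_nonneg]
  refine ENNReal.ofReal_le_ofReal ((pow_le_pow_left₀ measureReal_nonneg hμ m).trans_eq ?_)
  rw [← Real.exp_nat_mul]
  congr 1
  ring

/-- Union bound: for a finite class of `[0, 1]`-valued functions and a large enough i.i.d. sample,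
with probability at least `1 - δ / 2` no function of mean larger than `ε` vanishes on the whole
sample. -/
lemma measure_pi_exists_sum_eq_zero_le {Ω ι : Type*} [MeasurableSpace Ω] (μ : Measure Ω)
    [IsProbabilityMeasure μ] [Fintype ι] [Nonempty ι] {φ : ι → Ω → ℝ}
    (hφ : ∀ i, Measurable (φ i)) (hφ01 : ∀ i x, φ i x ∈ Set.Icc (0 : ℝ) 1) {ε δ : ℝ}
    (hε : 0 < ε) (hδ : 0 < δ) {m : ℕ}
    (hm : (1 / ε) * (Real.log (Nat.card ι) + Real.log (2 / δ)) ≤ m) :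
    (Measure.pi fun _ : Fin m => μ) {s | ∃ i, ε < ∫ x, φ i x ∂μ ∧ ∑ k, φ i (s k) = 0} ≤
      ENNReal.ofReal (δ / 2) := by
  have hcard : (0 : ℝ) < Nat.card ι := by exact_mod_cast Nat.card_pos
  have hbound : Nat.card ι * Real.exp (-(ε * m)) ≤ δ / 2 := by
    have hm' : Real.log (Nat.card ι) + Real.log (2 / δ) ≤ ε * m := by
      rw [one_div, inv_mul_le_iff₀ hε] at hm
      exact hm
    rw [← Real.log_mul hcard.ne' (by positivity), Real.log_le_iff_le_exp (by positivity)] at hm'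
    rw [Real.exp_neg, ← div_eq_mul_inv, div_le_iff₀ (Real.exp_pos _)]
    calc (Nat.card ι : ℝ) = δ / 2 * (Nat.card ι * (2 / δ)) := by field_simp
      _ ≤ _ := by gcongr
  calc
    _ ≤ ∑ _i : ι, ENNReal.ofReal (Real.exp (-(ε * m))) := by
      rw [Set.ofPred_exists]
      refine (measure_iUnion_fintype_le _ _).trans (Finset.sum_le_sum fun i _ => ?_)
      by_cases hi : ε < ∫ x, φ i x ∂μ
      · simpa [hi] using measure_pi_sum_eq_zero_le μ (hφ i) (hφ01 i) hi m
      · simp [hi]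
    _ = ENNReal.ofReal (Nat.card ι * Real.exp (-(ε * m))) := by
      rw [ENNReal.ofReal_mul hcard.le]
      simp
    _ ≤ _ := ENNReal.ofReal_le_ofReal hbound

theorem stmt_0
    {X Y Φ : Type*} [MeasurableSpace X] [MeasurableSpace Y] [MeasurableSpace Φ]
    (D : Measure (X × Y)) [IsProbabilityMeasure D]
    (DX : Measure X) [IsProbabilityMeasure DX] (hDX : D.map Prod.fst = DX)
    {H F G : Type*} [Fintype H] [Fintype F] [Fintype G]
    [Nonempty H] [Nonempty F] [Nonempty G]
    (hh : H → X → Φ) (ff : F → Φ → Y) (lc : Y → Y → ℝ)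
    (Lr : H → G → X → ℝ)
    (hmeas_h : ∀ h : H, Measurable (hh h))
    (hmeas_c : ∀ (f : F) (h : H), Measurable (fun p : X × Y => lc (ff f (hh h p.1)) p.2))
    (hmeas_r : ∀ (h : H) (g : G), Measurable (Lr h g))
    (hlc01 : ∀ y y', lc y y' ∈ Set.Icc (0:ℝ) 1)
    (hLr01 : ∀ h g x, Lr h g x ∈ Set.Icc (0:ℝ) 1)
    (hreal : ∃ (h : H) (f : F) (g : G),
      (∫ p, lc (ff f (hh h p.1)) p.2 ∂D) = 0 ∧ (∫ x, Lr h g x ∂DX) = 0)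
    (ε₀ ε₁ δ : ℝ) (hε₀ : ε₀ ∈ Set.Ioo (0:ℝ) (1/2)) (hε₁ : ε₁ ∈ Set.Ioo (0:ℝ) (1/2))
    (hδ : δ ∈ Set.Ioo (0:ℝ) 1)
    (mu ml : ℕ) (hmu0 : 0 < mu) (hml0 : 0 < ml)
    (hmu : (mu : ℝ) ≥
      (1/ε₀) * (Real.log (Nat.card G) + Real.log (Nat.card H) + Real.log (2/δ)))
    (hml : (ml : ℝ) ≥
      (1/ε₁) * (Real.log (Nat.card F) +
        Real.log (Nat.card {h : H // (⨅ g : G, ∫ x, Lr h g x ∂DX) ≤ ε₀}) +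
        Real.log (2/δ))) :
    ENNReal.ofReal (1 - δ) ≤
      ((Measure.pi fun _ : Fin mu => DX).prod (Measure.pi fun _ : Fin ml => D))
        {p : (Fin mu → X) × (Fin ml → X × Y) |
          ∀ (f : F) (h : H),
            ((1/(ml:ℝ)) * ∑ k, lc (ff f (hh h (p.2 k).1)) (p.2 k).2) = 0 →
            (⨅ g : G, (1/(mu:ℝ)) * ∑ k, Lr h g (p.1 k)) = 0 →
            (∫ q, lc (ff f (hh h q.1)) q.2 ∂D) ≤ ε₁} := by
  classical
  set P := Measure.pi fun _ : Fin mu => DX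
  set Q := Measure.pi fun _ : Fin ml => D
  obtain ⟨h₀, -, g₀, -, hr₀⟩ := hreal
  have ciInf_le_apply (h : H) (g : G) :
      (⨅ g : G, ∫ x, Lr h g x ∂DX) ≤ ∫ x, Lr h g x ∂DX :=
    ciInf_le (Set.finite_range _).bddBelow g
  let Hε := {h : H // (⨅ g : G, ∫ x, Lr h g x ∂DX) ≤ ε₀}
  have : Nonempty Hε := ⟨h₀, (ciInf_le_apply h₀ g₀).trans (hr₀.trans_le hε₀.1.le)⟩
  set A : Set (Fin mu → X) :=
    {s | ∃ i : G × H, ε₀ < ∫ x, Lr i.2 i.1 x ∂DX ∧ ∑ k, Lr i.2 i.1 (s k) = 0}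
  set B : Set (Fin ml → X × Y) :=
    {s | ∃ i : F × Hε, ε₁ < ∫ q, lc (ff i.1 (hh i.2 q.1)) q.2 ∂D ∧
      ∑ k, lc (ff i.1 (hh i.2 (s k).1)) (s k).2 = 0}
  have hA : P A ≤ ENNReal.ofReal (δ / 2) := by
    refine measure_pi_exists_sum_eq_zero_le DX (fun i : G × H => hmeas_r i.2 i.1)
      (fun i => hLr01 i.2 i.1) hε₀.1 hδ.1 ?_
    rw [Nat.card_prod, Nat.cast_mul, Real.log_mul (by simp) (by simp)]
    exact hmu
  have hB : Q B ≤ ENNReal.ofReal (δ / 2) := by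
    refine measure_pi_exists_sum_eq_zero_le D (fun i : F × Hε => hmeas_c i.1 i.2)
      (fun i q => hlc01 _ _) hε₁.1 hδ.1 ?_
    rw [Nat.card_prod, Nat.cast_mul, Real.log_mul (by simp) (by simp)]
    exact hml
  set good : Set ((Fin mu → X) × (Fin ml → X × Y)) := _
  change _ ≤ (P.prod Q) good
  have hcover : Set.univ ⊆ good ∪ (A ×ˢ Set.univ ∪ Set.univ ×ˢ B) := by
    rintro ⟨u, s⟩ -
    refine or_iff_not_imp_right.2 fun hbad f h hc hr => ?_
    simp only [Set.mem_union, Set.mem_prod, Set.mem_univ, and_true, true_and, not_or] at hbad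
    by_contra! hlt
    obtain ⟨g, hg⟩ := exists_eq_ciInf_of_finite (f := fun g => (1 / (mu : ℝ)) * ∑ k, Lr h g (u k))
    have hmem : (⨅ g : G, ∫ x, Lr h g x ∂DX) ≤ ε₀ := by
      by_contra! hτ
      refine hbad.1 ⟨(g, h), hτ.trans_le (ciInf_le_apply h g), ?_⟩
      exact (mul_eq_zero_iff_left (by positivity)).1 (hg.trans hr)
    exact hbad.2 ⟨(f, ⟨h, hmem⟩), hlt, (mul_eq_zero_iff_left (by positivity)).1 hc⟩
  have hone : 1 ≤ (P.prod Q) good + ENNReal.ofReal δ := by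
    calc 1 = (P.prod Q) Set.univ := measure_univ.symm
      _ ≤ (P.prod Q) good + ((P.prod Q) (A ×ˢ Set.univ) + (P.prod Q) (Set.univ ×ˢ B)) :=
        (measure_mono hcover).trans <| (measure_union_le _ _).trans <|
          add_le_add_right (measure_union_le _ _) _
      _ ≤ (P.prod Q) good + (ENNReal.ofReal (δ / 2) + ENNReal.ofReal (δ / 2)) := by
        gcongr
        · simpa [Measure.prod_prod] using hA
        · simpa [Measure.prod_prod] using hB
      _ = _ := by
        rw [← ENNReal.ofReal_add (by linarith [hδ.1]) (by linarith [hδ.1]), add_halves]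
  rw [ENNReal.ofReal_sub _ hδ.1.le, ENNReal.ofReal_one]
  exact tsub_le_iff_right.2 hone
end

section
/- There exists an absolute constant C > 0 with the following property. In the functional-regularization framework with countable classes H, F, G, with both the prediction loss ℓ_c and the regularization loss L_r taking values in {0,1} and all required maps measurable, suppose there exist h* ∈ H, f* ∈ F, g* ∈ G with L_c(f*, h*; D) ≤ ε_c and L_r(h*, g*; D_X) ≤ ε_r for some ε_c, ε_r ∈ [0,1]. Let ε₀, ε₁ ∈ (0, 1/2), δ ∈ (0, 1), and let m_u, m_l be positive integers with m_u ≥ (C/ε₀²) [d(G∘H) ln(1/ε₀) + ln(1/δ)] and m_l ≥ (C/ε₁²) [d(F∘H_{D_X,L_r}(ε_r + 2ε₀)) ln(1/ε₁) + ln(1/δ)]. Then with probability at least 1 − δ over an i.i.d. sample U of m_u points from D_X and an independent i.i.d. sample S of m_l points from D: every pair (f̂, ĥ) ∈ F × H with L_r(ĥ; U) ≤ ε_r + ε₀ and L_c(f̂, ĥ; S) ≤ L_c(f, h; S) for every (f, h) ∈ F × H with L_r(h; U) ≤ ε_r + ε₀, satisfies L_c(f̂, ĥ; D) ≤ L_c(f*,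 h*; D) + ε₁. -/
open MeasureTheory

/-- The VC dimension of a family of subsets of `Z`: the supremum of cardinalities of
finite subsets `T ⊆ Z` shattered by the family (`T` is shattered if every subset of `T`
equals `T ∩ A` for some member `A`). -/
noncomputable def vcDim {Z : Type*} (𝒮 : Set (Set Z)) : ℕ∞ :=
  ⨆ T ∈ {T : Finset Z | ∀ T' ∈ T.powerset, ∃ A ∈ 𝒮, (T : Set Z) ∩ A = (T' : Set Z)},
    (T.card : ℕ∞)

universe u v w

section

open ProbabilityTheory

open Finset hiding vcDim

/-- A finset shattered by a set family has at most `vcDim` many elements. -/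
lemma card_le_of_vcDim_le {Z : Type*} {𝒮 : Set (Set Z)} {d : ℕ} (hd : vcDim 𝒮 ≤ d) {T : Finset Z}
    (hT : ∀ T' ⊆ T, ∃ A ∈ 𝒮, (T : Set Z) ∩ A = T') : #T ≤ d := by
  have h : (#T : ℕ∞) ≤ vcDim 𝒮 :=
    le_iSup₂_of_le (f := fun (T : Finset Z) _ => (#T : ℕ∞)) T
      (fun T' h => hT T' (mem_powerset.1 h)) le_rfl
  exact_mod_cast h.trans hd

open Classical in
/-- The traces of a set family on a finite sequence of points. -/
noncomputable def traces {ι Z α : Type*} [Fintype α] (A : ι → Set Z) (p : α → Z) :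
    Finset (Finset α) :=
  univ.filter fun S => ∃ i, ∀ a, a ∈ S ↔ p a ∈ A i

open Classical in
lemma vcDim_traces_le {ι Z α : Type*} [Fintype α] {A : ι → Set Z} {d : ℕ}
    (hd : vcDim (Set.range A) ≤ d) (p : α → Z) : (traces A p).vcDim ≤ d := by
  refine Finset.sup_le fun S hS => ?_
  rw [mem_shatterer] at hS
  have trace : ∀ t ⊆ S, ∃ i, ∀ a ∈ S, p a ∈ A i ↔ a ∈ t := by
    intro t ht
    obtain ⟨u, hu, rfl⟩ := hS ht
    obtain ⟨i, hi⟩ := (mem_filter.1 hu).2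
    exact ⟨i, fun a ha => by simp [ha, hi]⟩
  have inj : Set.InjOn p S := by
    intro a ha b hb hab
    obtain ⟨i, hi⟩ := trace {a} (by simpa using ha)
    have h1 := hi a ha
    have h2 := hi b hb
    rw [hab] at h1
    simpa [eq_comm] using h2.1 (h1.2 (by simp))
  rw [← card_image_of_injOn inj]
  refine card_le_of_vcDim_le hd fun T' hT' => ?_
  obtain ⟨i, hi⟩ := trace (S.filter fun a => p a ∈ T') (filter_subset _ _)
  refine ⟨A i, ⟨i, rfl⟩, ?_⟩
  ext z
  simp only [coe_image, Set.mem_inter_iff, Set.mem_image, mem_coe]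
  constructor
  · rintro ⟨⟨a, ha, rfl⟩, hz⟩
    exact (mem_filter.1 ((hi a ha).1 hz)).2
  · intro hz
    obtain ⟨a, ha, rfl⟩ := mem_image.1 (hT' hz)
    exact ⟨⟨a, ha, rfl⟩, (hi a ha).2 (mem_filter.2 ⟨ha, hz⟩)⟩

lemma sum_Iic_choose_le (n d : ℕ) {x : ℝ} (hx : 0 < x) (hx1 : x ≤ 1) :
    (∑ k ∈ Iic d, (n.choose k : ℝ)) ≤ (x ^ d)⁻¹ * Real.exp (n * x) := by
  rw [inv_mul_eq_div, le_div_iff₀ (by positivity), Finset.sum_mul]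
  calc ∑ k ∈ Iic d, (n.choose k : ℝ) * x ^ d
      ≤ ∑ k ∈ Iic d, (n.choose k : ℝ) * x ^ k := by
        refine sum_le_sum fun k hk => ?_
        exact mul_le_mul_of_nonneg_left
          (pow_le_pow_of_le_one hx.le hx1 (mem_Iic.1 hk)) (by positivity)
    _ ≤ ∑ k ∈ range (n + d + 1), (n.choose k : ℝ) * x ^ k := by
        refine sum_le_sum_of_subset_of_nonneg (fun k hk => ?_) fun _ _ _ => by positivity
        simp only [mem_Iic, mem_range] at *
        lia
    _ = ∑ k ∈ range (n + 1), (n.choose k : ℝ) * x ^ k := by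
        refine (sum_subset (fun k hk => ?_) fun k _ hk => ?_).symm
        · simp only [mem_range] at *
          lia
        · rw [Nat.choose_eq_zero_of_lt (not_lt.1 fun h => hk (mem_range.2 h))]
          simp
    _ = (x + 1) ^ n := by
        rw [add_pow]
        exact sum_congr rfl fun k _ => by simp [mul_comm]
    _ ≤ Real.exp x ^ n := by
        exact pow_le_pow_left₀ (by positivity) (Real.add_one_le_exp x) n
    _ = Real.exp (n * x) := (Real.exp_nat_mul x n).symm

lemma card_traces_le {ι Z α : Type*} [Fintype α] {A : ι → Set Z} {d : ℕ}
    (hd : vcDim (Set.range A) ≤ d) (p : α → Z) {x : ℝ} (hx : 0 < x) (hx1 : x ≤ 1) :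
    (#(traces A p) : ℝ) ≤ (x ^ d)⁻¹ * Real.exp (Fintype.card α * x) := by
  classical
  refine le_trans ?_ (sum_Iic_choose_le (Fintype.card α) d hx hx1)
  have h : #(traces A p) ≤ ∑ k ∈ Iic d, (Fintype.card α).choose k :=
    ((card_le_card_shatterer _).trans card_shatterer_le_sum_vcDim).trans
      (sum_le_sum_of_subset (Iic_subset_Iic.2 (vcDim_traces_le hd p)))
  exact_mod_cast h

/-- The real sign encoded by a Boolean. -/
def boolSign (b : Bool) : ℝ := if b then 1 else -1

lemma sum_exp_signed_sum_le {m : ℕ} {v : Fin m → ℝ} (hv : ∀ k, |v k| ≤ 1) (s : ℝ) :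
    ∑ σ : Fin m → Bool, Real.exp (s * ∑ k, boolSign (σ k) * v k) ≤
      2 ^ m * Real.exp (m * (s ^ 2 / 2)) := by
  calc ∑ σ : Fin m → Bool, Real.exp (s * ∑ k, boolSign (σ k) * v k)
      = ∑ σ : Fin m → Bool, ∏ k, Real.exp (s * (boolSign (σ k) * v k)) := by
        simp_rw [Finset.mul_sum, Real.exp_sum]
    _ = ∏ k, ∑ b : Bool, Real.exp (s * (boolSign b * v k)) := by
        rw [Fintype.prod_sum]
    _ = ∏ k, (2 * Real.cosh (s * v k)) := by
        refine prod_congr rfl fun k _ => ?_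
        simp [boolSign, Real.cosh_eq]
        ring
    _ ≤ ∏ _k : Fin m, (2 * Real.exp (s ^ 2 / 2)) := by
        refine prod_le_prod (fun k _ => by positivity) fun k _ => ?_
        refine mul_le_mul_of_nonneg_left ((Real.cosh_le_exp_half_sq _).trans ?_) (by norm_num)
        have : v k ^ 2 ≤ 1 := (sq_le_one_iff_abs_le_one _).2 (hv k)
        refine Real.exp_le_exp.2 ?_
        rw [mul_pow]
        nlinarith [sq_nonneg s]
    _ = 2 ^ m * Real.exp (m * (s ^ 2 / 2)) := by
        simp [mul_pow, Real.exp_nat_mul]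

/-- One-sided Hoeffding inequality for Rademacher sums, in counting form. -/
lemma card_lt_signed_sum_le {m : ℕ} (hm : 0 < m) {v : Fin m → ℝ} (hv : ∀ k, |v k| ≤ 1) {t : ℝ}
    (ht : 0 ≤ t) :
    (#{σ : Fin m → Bool | t < ∑ k, boolSign (σ k) * v k} : ℝ) ≤
      2 ^ m * Real.exp (-(t ^ 2 / (2 * m))) := by
  have hm' : (0 : ℝ) < m := by exact_mod_cast hm
  set s : ℝ := t / m
  have hs : 0 ≤ s := by positivity
  have markov : (#{σ : Fin m → Bool | t < ∑ k, boolSign (σ k) * v k} : ℝ) * Real.exp (s * t) ≤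
      ∑ σ : Fin m → Bool, Real.exp (s * ∑ k, boolSign (σ k) * v k) := by
    rw [← nsmul_eq_mul]
    refine le_trans (card_nsmul_le_sum _ _ _ fun σ hσ => ?_)
      (sum_le_sum_of_subset_of_nonneg (subset_univ _) fun _ _ _ => by positivity)
    exact Real.exp_le_exp.2 (mul_le_mul_of_nonneg_left (mem_filter.1 hσ).2.le hs)
  have h := markov.trans (sum_exp_signed_sum_le hv s)
  rw [← le_div_iff₀ (Real.exp_pos _), mul_div_assoc, ← Real.exp_sub] at h
  have hexp : m * (s ^ 2 / 2) - s * t = -(t ^ 2 / (2 * m)) := by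
    simp only [s]
    field_simp
    ring
  rwa [hexp] at h

/-- Two-sided Hoeffding inequality for Rademacher sums, in counting form. -/
lemma card_lt_abs_signed_sum_le {m : ℕ} (hm : 0 < m) {v : Fin m → ℝ} (hv : ∀ k, |v k| ≤ 1) {t : ℝ}
    (ht : 0 ≤ t) :
    (#{σ : Fin m → Bool | t < |∑ k, boolSign (σ k) * v k|} : ℝ) ≤
      2 ^ m * (2 * Real.exp (-(t ^ 2 / (2 * m)))) := by
  have h1 := card_lt_signed_sum_le hm hv ht
  have h2 := card_lt_signed_sum_le hm (v := -v) (by simpa using hv) ht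
  have h : #{σ : Fin m → Bool | t < |∑ k, boolSign (σ k) * v k|} ≤
      #{σ : Fin m → Bool | t < ∑ k, boolSign (σ k) * v k} +
      #{σ : Fin m → Bool | t < ∑ k, boolSign (σ k) * (-v) k} := by
    refine le_trans (card_le_card fun σ hσ => ?_) (card_union_le _ _)
    simp only [mem_filter, mem_univ, true_and, lt_abs, mem_union, Pi.neg_apply, mul_neg,
      sum_neg_distrib] at hσ ⊢
    exact hσ
  have h' : (#{σ : Fin m → Bool | t < |∑ k, boolSign (σ k) * v k|} : ℝ) ≤
      #{σ : Fin m → Bool | t < ∑ k, boolSign (σ k) * v k} +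
      #{σ : Fin m → Bool | t < ∑ k, boolSign (σ k) * (-v) k} := by exact_mod_cast h
  linarith

open Classical in
/-- Union bound over the traces: for few sign patterns some member of a VC class has a large
Rademacher sum. -/
lemma card_exists_lt_abs_signed_sum_le {ι Z : Type*} {φ : ι → Z → ℝ}
    (hφ : ∀ i z, φ i z = 0 ∨ φ i z = 1) {d : ℕ}
    (hd : vcDim (Set.range fun i => {z | φ i z = 1}) ≤ d) {m : ℕ} (hm : 0 < m)
    (w : Fin m → Z × Z) {t : ℝ} (ht : 0 ≤ t) {x : ℝ} (hx : 0 < x) (hx1 : x ≤ 1) :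
    (#{σ : Fin m → Bool | ∃ i, t < |∑ k, boolSign (σ k) * (φ i (w k).1 - φ i (w k).2)|} : ℝ) ≤
      2 ^ m * ((x ^ d)⁻¹ * Real.exp (2 * m * x) * (2 * Real.exp (-(t ^ 2 / (2 * m))))) := by
  set p : Fin m ⊕ Fin m → Z := Sum.elim (fun k => (w k).1) (fun k => (w k).2)
  set 𝒯 := traces (fun i => {z | φ i z = 1}) p
  set v : Finset (Fin m ⊕ Fin m) → Fin m → ℝ := fun S k =>
    (if Sum.inl k ∈ S then 1 else 0) - (if Sum.inr k ∈ S then 1 else 0)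
  have hv : ∀ S k, |v S k| ≤ 1 := by
    intro S k
    simp only [v]
    split_ifs <;> simp
  have cover : ({σ : Fin m → Bool | ∃ i, t < |∑ k, boolSign (σ k) * (φ i (w k).1 - φ i (w k).2)|} :
      Finset (Fin m → Bool)) ⊆
      𝒯.biUnion fun S => {σ : Fin m → Bool | t < |∑ k, boolSign (σ k) * v S k|} := by
    intro σ hσ
    obtain ⟨i, hi⟩ := (mem_filter.1 hσ).2
    refine mem_biUnion.2 ⟨univ.filter fun a => φ i (p a) = 1, ?_, ?_⟩
    · exact mem_filter.2 ⟨mem_univ _, i, fun a => by simp⟩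
    · refine mem_filter.2 ⟨mem_univ _, ?_⟩
      have ind : ∀ z, (if φ i z = 1 then (1 : ℝ) else 0) = φ i z := by
        intro z
        rcases hφ i z with h | h <;> simp [h]
      have hvi : ∀ k, v (univ.filter fun a => φ i (p a) = 1) k = φ i (w k).1 - φ i (w k).2 := by
        intro k
        simp [v, p, ind]
      simpa only [hvi] using hi
  have h1 : (#{σ : Fin m → Bool | ∃ i, t < |∑ k, boolSign (σ k) * (φ i (w k).1 - φ i (w k).2)|} : ℝ)
      ≤ ∑ S ∈ 𝒯, (#{σ : Fin m → Bool | t < |∑ k, boolSign (σ k) * v S k|} : ℝ) := by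
    exact_mod_cast (card_le_card cover).trans card_biUnion_le
  refine h1.trans ((sum_le_card_nsmul 𝒯 _ _
    fun S _ => card_lt_abs_signed_sum_le hm (hv S) ht).trans ?_)
  rw [nsmul_eq_mul]
  have h2 := card_traces_le hd p hx hx1
  have h3 : ((Fintype.card (Fin m ⊕ Fin m) : ℕ) : ℝ) = 2 * m := by
    simp
    ring
  rw [h3] at h2
  calc (#𝒯 : ℝ) * (2 ^ m * (2 * Real.exp (-(t ^ 2 / (2 * m)))))
      ≤ ((x ^ d)⁻¹ * Real.exp (2 * m * x)) * (2 ^ m * (2 * Real.exp (-(t ^ 2 / (2 * m))))) := by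
        gcongr
    _ = _ := by ring

/-- Exchanges the two coordinates of each pair with negative sign. -/
def swapBySign {m : ℕ} {Z : Type*} (σ : Fin m → Bool) (w : Fin m → Z × Z) : Fin m → Z × Z :=
  fun k => if σ k then w k else (w k).swap

lemma measurePreserving_swapBySign {m : ℕ} {Z : Type*} [MeasurableSpace Z] (P : Measure Z)
    [IsProbabilityMeasure P] (σ : Fin m → Bool) :
    MeasurePreserving (swapBySign σ) (Measure.pi fun _ : Fin m => P.prod P)
      (Measure.pi fun _ : Fin m => P.prod P) := by
  refine measurePreserving_pi (fun _ => P.prod P) (fun _ => P.prod P)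
    (f := fun k (q : Z × Z) => if σ k then q else q.swap) fun k => ?_
  cases σ k
  · simpa using Measure.measurePreserving_swap (μ := P) (ν := P)
  · exact MeasurePreserving.id (P.prod P)

lemma measurableSet_exists_lt_abs_sum_sub {ι Z : Type*} [Countable ι] [MeasurableSpace Z]
    {φ : ι → Z → ℝ} (hφm : ∀ i, Measurable (φ i)) (m : ℕ) (t : ℝ) :
    MeasurableSet {w : Fin m → Z × Z | ∃ i, t < |∑ k, (φ i (w k).1 - φ i (w k).2)|} := by
  rw [Set.ofPred_exists]
  refine MeasurableSet.iUnion fun i => measurableSet_lt measurable_const ?_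
  have := hφm i
  fun_prop

/-- Symmetrized deviation bound: two independent samples rarely disagree on a VC class. -/
lemma measure_exists_lt_abs_sum_sub_le {ι Z : Type*} [Countable ι] [MeasurableSpace Z]
    (P : Measure Z) [IsProbabilityMeasure P] {φ : ι → Z → ℝ}
    (hφ : ∀ i z, φ i z = 0 ∨ φ i z = 1) (hφm : ∀ i, Measurable (φ i)) {d : ℕ}
    (hd : vcDim (Set.range fun i => {z | φ i z = 1}) ≤ d) {m : ℕ} (hm : 0 < m)
    {t : ℝ} (ht : 0 ≤ t) {x : ℝ} (hx : 0 < x) (hx1 : x ≤ 1) :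
    (Measure.pi fun _ : Fin m => P.prod P)
        {w | ∃ i, t < |∑ k, (φ i (w k).1 - φ i (w k).2)|} ≤
      ENNReal.ofReal
        ((x ^ d)⁻¹ * Real.exp (2 * m * x) * (2 * Real.exp (-(t ^ 2 / (2 * m))))) := by
  classical
  set R := (x ^ d)⁻¹ * Real.exp (2 * m * x) * (2 * Real.exp (-(t ^ 2 / (2 * m))))
  set Q := Measure.pi fun _ : Fin m => P.prod P
  set B := {w : Fin m → Z × Z | ∃ i, t < |∑ k, (φ i (w k).1 - φ i (w k).2)|}
  have hB : MeasurableSet B := measurableSet_exists_lt_abs_sum_sub hφm m t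
  have hBσ : ∀ σ, MeasurableSet (swapBySign σ ⁻¹' B) := fun σ =>
    (measurePreserving_swapBySign P σ).measurable hB
  have hswap : ∀ (σ : Fin m → Bool) (w : Fin m → Z × Z), swapBySign σ w ∈ B ↔
      ∃ i, t < |∑ k, boolSign (σ k) * (φ i (w k).1 - φ i (w k).2)| := by
    intro σ w
    have : ∀ i k, φ i (swapBySign σ w k).1 - φ i (swapBySign σ w k).2 =
        boolSign (σ k) * (φ i (w k).1 - φ i (w k).2) := by
      intro i k
      cases h : σ k <;> simp [swapBySign, boolSign, h]
    simp only [B, Set.mem_ofPred_eq, this]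
  have count : ∀ w, ∑ σ, (swapBySign σ ⁻¹' B).indicator (1 : (Fin m → Z × Z) → ENNReal) w ≤
      ENNReal.ofReal (2 ^ m * R) := by
    intro w
    have h := card_exists_lt_abs_signed_sum_le hφ hd hm w ht hx hx1
    simp only [Set.indicator_apply, Set.mem_preimage, hswap, Pi.one_apply, sum_boole]
    rw [← ENNReal.ofReal_natCast]
    exact ENNReal.ofReal_le_ofReal h
  have key : 2 ^ m * Q B ≤ 2 ^ m * ENNReal.ofReal R := by
    calc 2 ^ m * Q B = ∑ σ : Fin m → Bool, Q (swapBySign σ ⁻¹' B) := by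
          simp [(measurePreserving_swapBySign P _).measure_preimage hB.nullMeasurableSet, Q]
      _ = ∑ σ : Fin m → Bool, ∫⁻ w, (swapBySign σ ⁻¹' B).indicator 1 w ∂Q := by
          simp [lintegral_indicator_one (hBσ _)]
      _ = ∫⁻ w, ∑ σ : Fin m → Bool, (swapBySign σ ⁻¹' B).indicator 1 w ∂Q :=
          (lintegral_finsetSum _ fun σ _ => measurable_one.indicator (hBσ σ)).symm
      _ ≤ ∫⁻ _, ENNReal.ofReal (2 ^ m * R) ∂Q := lintegral_mono count
      _ = 2 ^ m * ENNReal.ofReal R := by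
          rw [lintegral_const, measure_univ, mul_one, ENNReal.ofReal_mul (by positivity)]
          simp [ENNReal.ofReal_pow]
  exact (ENNReal.mul_le_mul_iff_right (by positivity) (by finiteness)).1 key

/-- Chebyshev's inequality for the sum of a sample of a `[0, 1]`-valued function. -/
lemma measure_le_abs_sum_sub_integral_le {Z : Type*} [MeasurableSpace Z] (P : Measure Z)
    [IsProbabilityMeasure P] {f : Z → ℝ} (hf : ∀ z, f z ∈ Set.Icc (0 : ℝ) 1) (hfm : Measurable f)
    (m : ℕ) {t : ℝ} (ht : 0 < t) :
    (Measure.pi fun _ : Fin m => P) {z | t ≤ |∑ k, f (z k) - m * ∫ q, f q ∂P|} ≤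
      ENNReal.ofReal (m / (4 * t ^ 2)) := by
  set Q := Measure.pi fun _ : Fin m => P
  have hL : MemLp f 2 P := MemLp.of_bound hfm.aestronglyMeasurable 1
    (.of_forall fun z => by rw [Real.norm_eq_abs, abs_of_nonneg (hf z).1]; exact (hf z).2)
  have hLk : ∀ k : Fin m, MemLp (fun z : Fin m → Z => f (z k)) 2 Q := fun k =>
    hL.comp_measurePreserving (measurePreserving_eval (fun _ => P) k)
  have hmean : ∫ z, ∑ k, f (z k) ∂Q = m * ∫ q, f q ∂P := by
    rw [integral_finsetSum _ fun k _ => (hLk k).integrable one_le_two]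
    have : ∀ k : Fin m, ∫ z, f (z k) ∂Q = ∫ q, f q ∂P := fun k =>
      integral_comp_eval (μ := fun _ : Fin m => P) hfm.aestronglyMeasurable
    simp [this]
  have hvar : Var[fun z => ∑ k, f (z k); Q] ≤ m / 4 := by
    have h1 : Var[∑ k, fun z : Fin m → Z => f (z k); Q] = ∑ _k : Fin m, Var[f; P] :=
      variance_sum_pi (X := fun _ => f) fun _ => hL
    have h2 : Var[f; P] ≤ ((1 - 0) / 2) ^ 2 :=
      variance_le_sq_of_bounded (.of_forall hf) hfm.aemeasurable
    have h3 : (∑ k, fun z : Fin m → Z => f (z k)) = fun z => ∑ k, f (z k) := by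
      ext z
      simp
    rw [h3] at h1
    rw [h1, sum_const, card_univ, Fintype.card_fin, nsmul_eq_mul]
    nlinarith [(Nat.cast_nonneg m : (0 : ℝ) ≤ m)]
  have h := meas_ge_le_variance_div_sq (memLp_finsetSum univ fun k _ => hLk k) ht
  rw [hmean] at h
  refine h.trans (ENNReal.ofReal_le_ofReal ?_)
  rw [← div_div]
  gcongr

/-- Symmetrization by a ghost sample. -/
lemma measure_exists_lt_abs_sum_sub_integral_le {ι Z : Type*} [Countable ι] [MeasurableSpace Z]
    (P : Measure Z) [IsProbabilityMeasure P] {φ : ι → Z → ℝ}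
    (hφ : ∀ i z, φ i z ∈ Set.Icc (0 : ℝ) 1) (hφm : ∀ i, Measurable (φ i)) {m : ℕ} {t : ℝ}
    (ht : 0 < t) (hmt : m ≤ 2 * t ^ 2) :
    (Measure.pi fun _ : Fin m => P) {z | ∃ i, 2 * t < |∑ k, φ i (z k) - m * ∫ q, φ i q ∂P|} ≤
      2 * (Measure.pi fun _ : Fin m => P.prod P)
        {w | ∃ i, t < |∑ k, (φ i (w k).1 - φ i (w k).2)|} := by
  set Q := Measure.pi fun _ : Fin m => P
  set N := {z : Fin m → Z | ∃ i, 2 * t < |∑ k, φ i (z k) - m * ∫ q, φ i q ∂P|}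
  set B' := {p : (Fin m → Z) × (Fin m → Z) | ∃ i, t < |∑ k, (φ i (p.1 k) - φ i (p.2 k))|}
  have hN : MeasurableSet N := by
    simp only [N, Set.ofPred_exists]
    refine MeasurableSet.iUnion fun i => measurableSet_lt measurable_const ?_
    have := hφm i
    fun_prop
  have hB' : MeasurableSet B' := by
    simp only [B', Set.ofPred_exists]
    refine MeasurableSet.iUnion fun i => measurableSet_lt measurable_const ?_
    have := hφm i
    fun_prop
  have hpair : (Measure.pi fun _ : Fin m => P.prod P)
      {w | ∃ i, t < |∑ k, (φ i (w k).1 - φ i (w k).2)|} = Q.prod Q B' := by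
    rw [← (measurePreserving_arrowProdEquivProdArrow Z Z (Fin m) (fun _ => P)
      (fun _ => P)).measure_preimage hB'.nullMeasurableSet]
    rfl
  have slice : ∀ z ∈ N, (1 / 2 : ENNReal) ≤ Q (Prod.mk z ⁻¹' B') := by
    rintro z ⟨i, hi⟩
    have hcheb := measure_le_abs_sum_sub_integral_le P (hφ i) (hφm i) m ht
    set E := {z : Fin m → Z | t ≤ |∑ k, φ i (z k) - m * ∫ q, φ i q ∂P|}
    have hE : MeasurableSet E := by
      refine measurableSet_le measurable_const ?_
      have := hφm i
      fun_prop
    have hhalf : Q E ≤ 1 / 2 := by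
      refine hcheb.trans ?_
      rw [← ENNReal.ofReal_one, ← ENNReal.ofReal_ofNat, ← ENNReal.ofReal_div_of_pos (by norm_num)]
      refine ENNReal.ofReal_le_ofReal ?_
      rw [div_le_iff₀ (by positivity)]
      linarith
    have hsub : Eᶜ ⊆ Prod.mk z ⁻¹' B' := by
      intro z' hz'
      refine ⟨i, ?_⟩
      have hlt : |∑ k, φ i (z' k) - m * ∫ q, φ i q ∂P| < t := not_le.1 hz'
      have htri := abs_sub_abs_le_abs_sub (∑ k, φ i (z k) - m * ∫ q, φ i q ∂P)
        (∑ k, φ i (z' k) - m * ∫ q, φ i q ∂P)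
      rw [sub_sub_sub_cancel_right] at htri
      rw [sum_sub_distrib]
      linarith
    refine le_trans ?_ (measure_mono hsub)
    rw [prob_compl_eq_one_sub hE]
    refine le_trans (le_of_eq ?_) (tsub_le_tsub_left hhalf 1)
    rw [one_div, ENNReal.one_sub_inv_two]
  rw [hpair, Measure.prod_apply hB']
  have hlow : (1 / 2) * Q N ≤ ∫⁻ z, Q (Prod.mk z ⁻¹' B') ∂Q := by
    rw [← setLIntegral_const]
    exact (setLIntegral_mono' hN slice).trans (setLIntegral_le_lintegral _ _)
  calc Q N = 2 * ((1 / 2) * Q N) := by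
        rw [← mul_assoc, one_div, ENNReal.mul_inv_cancel (by norm_num) (by norm_num), one_mul]
    _ ≤ _ := by gcongr

lemma four_mul_le_half_of_le {d m : ℕ} {ε δ : ℝ} (hd : 0 < d) (hε : ε ∈ Set.Ioo (0 : ℝ) (1 / 2))
    (hδ : δ ∈ Set.Ioo (0 : ℝ) 1)
    (h : 160 * (d * Real.log (1 / ε) + Real.log (1 / δ)) ≤ m * ε ^ 2) :
    4 * (((ε ^ 2 / 32) ^ d)⁻¹ * Real.exp (-(m * ε ^ 2 / 16))) ≤ δ / 2 := by
  obtain ⟨hε0, hε1⟩ := hε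
  obtain ⟨hδ0, hδ1⟩ := hδ
  have hd' : (1 : ℝ) ≤ d := by exact_mod_cast hd
  set L := Real.log (1 / ε)
  have hL : Real.log 2 ≤ L := Real.log_le_log (by norm_num) (by
    rw [le_div_iff₀ hε0]
    linarith)
  have hl2 : 0 < Real.log 2 := Real.log_pos (by norm_num)
  have hδlog : 0 ≤ Real.log (1 / δ) := Real.log_nonneg (by
    rw [le_div_iff₀ hδ0]
    linarith)
  have hLε : Real.log ε = -L := by simp [L]
  have hx : Real.log (ε ^ 2 / 32) = -(2 * L + 5 * Real.log 2) := by
    rw [Real.log_div (by positivity) (by norm_num), Real.log_pow, hLε,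
      show (32 : ℝ) = 2 ^ 5 by norm_num, Real.log_pow]
    push_cast
    ring
  have hpow : ((ε ^ 2 / 32) ^ d)⁻¹ = Real.exp (d * (2 * L + 5 * Real.log 2)) := by
    rw [← Real.exp_log (show (0 : ℝ) < ε ^ 2 / 32 by positivity), ← Real.exp_nat_mul,
      ← Real.exp_neg, hx]
    ring_nf
  have h4 : (4 : ℝ) = Real.exp (2 * Real.log 2) := by
    rw [mul_comm, Real.exp_mul, Real.exp_log (by norm_num)]
    norm_num
  have hδ2 : δ / 2 = Real.exp (-Real.log (1 / δ) - Real.log 2) := by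
    rw [Real.exp_sub, Real.exp_log (by norm_num), one_div, Real.log_inv, neg_neg, Real.exp_log hδ0]
  rw [hpow, h4, hδ2, ← Real.exp_add, ← Real.exp_add, Real.exp_le_exp]
  have hdL : Real.log 2 ≤ d * L := by nlinarith
  have hdl : d * Real.log 2 ≤ d * L := by gcongr
  linarith

/-- Uniform convergence of empirical means over a class of positive VC dimension. -/
lemma measure_exists_lt_abs_empirical_sub_le {ι Z : Type*} [Countable ι] [MeasurableSpace Z]
    (P : Measure Z) [IsProbabilityMeasure P] {φ : ι → Z → ℝ}
    (hφ : ∀ i z, φ i z = 0 ∨ φ i z = 1) (hφm : ∀ i, Measurable (φ i)) {d : ℕ} (hd0 : 0 < d)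
    (hd : vcDim (Set.range fun i => {z | φ i z = 1}) ≤ d) {m : ℕ} (hm : 0 < m) {ε δ : ℝ}
    (hε : ε ∈ Set.Ioo (0 : ℝ) (1 / 2)) (hδ : δ ∈ Set.Ioo (0 : ℝ) 1)
    (h : 160 / ε ^ 2 * (d * Real.log (1 / ε) + Real.log (1 / δ)) ≤ m) :
    (Measure.pi fun _ : Fin m => P)
        {z | ∃ i, ε < |1 / (m : ℝ) * ∑ k, φ i (z k) - ∫ q, φ i q ∂P|} ≤
      ENNReal.ofReal (δ / 2) := by
  obtain ⟨hε0, hε1⟩ := hε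
  have hm' : (0 : ℝ) < m := by exact_mod_cast hm
  have h' : 160 * (d * Real.log (1 / ε) + Real.log (1 / δ)) ≤ m * ε ^ 2 := by
    rwa [div_mul_eq_mul_div, div_le_iff₀ (by positivity)] at h
  have hmε : 2 ≤ m * ε ^ 2 := by
    have hd' : (1 : ℝ) ≤ d := by exact_mod_cast hd0
    have hL : Real.log 2 ≤ Real.log (1 / ε) := Real.log_le_log (by norm_num) (by
      rw [le_div_iff₀ hε0]
      linarith)
    have hl2 := Real.log_two_gt_d9
    have hδlog : 0 ≤ Real.log (1 / δ) := Real.log_nonneg (by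
      rw [le_div_iff₀ hδ.1]
      linarith [hδ.2])
    nlinarith
  have hφI : ∀ i z, φ i z ∈ Set.Icc (0 : ℝ) 1 := by
    intro i z
    rcases hφ i z with h0 | h0 <;> simp [h0]
  have hset : {z : Fin m → Z | ∃ i, ε < |1 / (m : ℝ) * ∑ k, φ i (z k) - ∫ q, φ i q ∂P|} =
      {z | ∃ i, 2 * (m * ε / 2) < |∑ k, φ i (z k) - m * ∫ q, φ i q ∂P|} := by
    ext z
    refine exists_congr fun i => ?_
    have : ∑ k, φ i (z k) - m * ∫ q, φ i q ∂P =
        m * (1 / (m : ℝ) * ∑ k, φ i (z k) - ∫ q, φ i q ∂P) := by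
      field_simp
    rw [this, abs_mul, abs_of_pos hm', mul_div_cancel₀ _ two_ne_zero, mul_lt_mul_iff_right₀ hm']
  rw [hset]
  refine (measure_exists_lt_abs_sum_sub_integral_le P hφI hφm (by positivity) ?_).trans ?_
  · nlinarith
  refine (mul_le_mul_right (measure_exists_lt_abs_sum_sub_le P hφ hφm hd hm (by positivity)
    (x := ε ^ 2 / 32) (by positivity) (by nlinarith)) 2).trans ?_
  rw [← ENNReal.ofReal_ofNat, ← ENNReal.ofReal_mul (by norm_num)]
  refine ENNReal.ofReal_le_ofReal (le_trans (le_of_eq ?_)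
    (four_mul_le_half_of_le hd0 ⟨hε0, hε1⟩ hδ h'))
  have hexp : Real.exp (2 * m * (ε ^ 2 / 32)) * Real.exp (-((m * ε / 2) ^ 2 / (2 * m))) =
      Real.exp (-(m * ε ^ 2 / 16)) := by
    rw [← Real.exp_add]
    congr 1
    field_simp
    ring
  rw [← hexp]
  ring

lemma eq_of_vcDim_le_zero {ι Z : Type*} {φ : ι → Z → ℝ} (hφ : ∀ i z, φ i z = 0 ∨ φ i z = 1)
    (hd : vcDim (Set.range fun i => {z | φ i z = 1}) ≤ (0 : ℕ)) (i j : ι) : φ i = φ j := by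
  classical
  by_contra hne
  obtain ⟨z, hz⟩ := Function.ne_iff.1 hne
  have hex : ∀ c : ℝ, c = 0 ∨ c = 1 → ∃ l, φ l z = c := by
    rintro c (rfl | rfl) <;> rcases hφ i z with h1 | h1 <;> rcases hφ j z with h2 | h2 <;>
      first | exact ⟨i, h1⟩ | exact ⟨j, h2⟩ | exact absurd (h1.trans h2.symm) hz
  have := card_le_of_vcDim_le hd (T := {z}) fun T' hT' => by
    rcases subset_singleton_iff.1 hT' with rfl | rfl
    · obtain ⟨l, hl⟩ := hex 0 (.inl rfl)
      exact ⟨_, ⟨l, rfl⟩, by ext y; simp +contextual [hl]⟩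
    · obtain ⟨l, hl⟩ := hex 1 (.inr rfl)
      exact ⟨_, ⟨l, rfl⟩, by ext y; simp +contextual [hl]⟩
  simp at this

/-- With high probability, empirical means are uniformly close to expectations, unless the class
is trivial. -/
lemma exists_uniform_convergence_event {ι Z : Type*} [Countable ι] [MeasurableSpace Z]
    (P : Measure Z) [IsProbabilityMeasure P] {φ : ι → Z → ℝ}
    (hφ : ∀ i z, φ i z = 0 ∨ φ i z = 1) (hφm : ∀ i, Measurable (φ i)) {d : ℕ}
    (hd : vcDim (Set.range fun i => {z | φ i z = 1}) ≤ d) {m : ℕ} (hm : 0 < m) {ε δ : ℝ}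
    (hε : ε ∈ Set.Ioo (0 : ℝ) (1 / 2)) (hδ : δ ∈ Set.Ioo (0 : ℝ) 1)
    (h : 160 / ε ^ 2 * (d * Real.log (1 / ε) + Real.log (1 / δ)) ≤ m) :
    ∃ E : Set (Fin m → Z), ENNReal.ofReal (1 - δ / 2) ≤ (Measure.pi fun _ : Fin m => P) E ∧
      ∀ z ∈ E, (∀ i j, φ i = φ j) ∨
        ∀ i, |1 / (m : ℝ) * ∑ k, φ i (z k) - ∫ q, φ i q ∂P| ≤ ε := by
  rcases Nat.eq_zero_or_pos d with rfl | hd0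
  · refine ⟨Set.univ, ?_, fun _ _ => .inl (eq_of_vcDim_le_zero hφ hd)⟩
    rw [measure_univ, ENNReal.ofReal_le_one]
    linarith [hδ.1]
  · have hN := measure_exists_lt_abs_empirical_sub_le P hφ hφm hd0 hd hm hε hδ h
    set N := {z : Fin m → Z | ∃ i, ε < |1 / (m : ℝ) * ∑ k, φ i (z k) - ∫ q, φ i q ∂P|}
    refine ⟨Nᶜ, ?_, fun z hz => .inr fun i => not_lt.1 fun hi => hz ⟨i, hi⟩⟩
    rw [ENNReal.ofReal_sub _ (by linarith [hδ.1]), ENNReal.ofReal_one, tsub_le_iff_left]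
    refine le_trans ?_ (add_le_add_left hN _)
    rw [← measure_univ (μ := Measure.pi fun _ : Fin m => P), ← Set.union_compl_self N]
    exact measure_union_le _ _

lemma sample_size_half {d m : ℕ} {ε δ : ℝ} (hε : ε ∈ Set.Ioo (0 : ℝ) (1 / 2))
    (hδ : δ ∈ Set.Ioo (0 : ℝ) 1)
    (h : 1280 / ε ^ 2 * (d * Real.log (1 / ε) + Real.log (1 / δ)) ≤ m) :
    160 / (ε / 2) ^ 2 * (d * Real.log (1 / (ε / 2)) + Real.log (1 / δ)) ≤ m := by
  obtain ⟨hε0, hε1⟩ := hε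
  have hδlog : 0 ≤ Real.log (1 / δ) := Real.log_nonneg (by
    rw [le_div_iff₀ hδ.1]
    linarith [hδ.2])
  have hL : Real.log (1 / (ε / 2)) ≤ 2 * Real.log (1 / ε) := by
    rw [show (2 : ℝ) * Real.log (1 / ε) = Real.log ((1 / ε) ^ 2) by simp]
    refine Real.log_le_log (by positivity) ?_
    rw [div_pow, div_le_div_iff₀ (by positivity) (by positivity)]
    nlinarith
  refine le_trans ?_ h
  calc 160 / (ε / 2) ^ 2 * (d * Real.log (1 / (ε / 2)) + Real.log (1 / δ))
      ≤ 160 / (ε / 2) ^ 2 * (2 * (d * Real.log (1 / ε) + Real.log (1 / δ))) := by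
        refine mul_le_mul_of_nonneg_left ?_ (by positivity)
        have := mul_le_mul_of_nonneg_left hL (Nat.cast_nonneg d : (0 : ℝ) ≤ d)
        linarith
    _ = _ := by
        field_simp
        ring

end

theorem stmt_4 : ∃ Cabs : ℝ, 0 < Cabs ∧
    ∀ (X : Type u) (Y : Type v) (Φ : Type w) (H F G : Type)
      [MeasurableSpace X] [MeasurableSpace Y] [MeasurableSpace Φ]
      [Countable H] [Countable F] [Countable G]
      [Nonempty H] [Nonempty F] [Nonempty G]
      (D : Measure (X × Y)) (_ : IsProbabilityMeasure D)
      (DX : Measure X) (_ : IsProbabilityMeasure DX) (_ : D.map Prod.fst = DX)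
      (hh : H → X → Φ) (ff : F → Φ → Y) (lc : Y → Y → ℝ) (Lr : H → G → X → ℝ)
      (_ : ∀ h : H, Measurable (hh h))
      (_ : ∀ (f : F) (h : H), Measurable (fun p : X × Y => lc (ff f (hh h p.1)) p.2))
      (_ : ∀ (h : H) (g : G), Measurable (Lr h g))
      -- the losses take values in {0, 1}
      (_ : ∀ y y', lc y y' = 0 ∨ lc y y' = 1)
      (_ : ∀ h g x, Lr h g x = 0 ∨ Lr h g x = 1)
      (εc εr : ℝ) (_ : εc ∈ Set.Icc (0:ℝ) 1) (_ : εr ∈ Set.Icc (0:ℝ) 1)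
      -- the "ground-truth" hypotheses h*, f*, g*
      (hs : H) (fs : F) (gs : G)
      (_ : (∫ p, lc (ff fs (hh hs p.1)) p.2 ∂D) ≤ εc)
      (_ : (∫ x, Lr hs gs x ∂DX) ≤ εr)
      (ε₀ ε₁ δ : ℝ) (_ : ε₀ ∈ Set.Ioo (0:ℝ) (1/2)) (_ : ε₁ ∈ Set.Ioo (0:ℝ) (1/2))
      (_ : δ ∈ Set.Ioo (0:ℝ) 1)
      (dGH dFH : ℕ)
      -- VC dimension of G ∘ H
      (_ : vcDim {s : Set X | ∃ (h : H) (g : G), s = {x | Lr h g x = 1}} = (dGH : ℕ∞))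
      -- VC dimension of F ∘ H_{D_X, L_r}(ε_r + 2ε₀)
      (_ : vcDim {s : Set (X × Y) | ∃ (f : F) (h : H),
            (⨅ g : G, ∫ x, Lr h g x ∂DX) ≤ εr + 2 * ε₀ ∧
            s = {q : X × Y | lc (ff f (hh h q.1)) q.2 = 1}} = (dFH : ℕ∞))
      (mu ml : ℕ) (_ : 0 < mu) (_ : 0 < ml)
      (_ : (mu : ℝ) ≥ (Cabs/ε₀^2) * ((dGH : ℝ) * Real.log (1/ε₀) + Real.log (1/δ)))
      (_ : (ml : ℝ) ≥ (Cabs/ε₁^2) * ((dFH : ℝ) * Real.log (1/ε₁) + Real.log (1/δ))),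
      ENNReal.ofReal (1 - δ) ≤
        ((Measure.pi fun _ : Fin mu => DX).prod (Measure.pi fun _ : Fin ml => D))
          {p : (Fin mu → X) × (Fin ml → X × Y) |
            ∀ (f : F) (h : H),
              (⨅ g : G, (1/(mu:ℝ)) * ∑ k, Lr h g (p.1 k)) ≤ εr + ε₀ →
              (∀ (f' : F) (h' : H),
                (⨅ g : G, (1/(mu:ℝ)) * ∑ k, Lr h' g (p.1 k)) ≤ εr + ε₀ →
                (1/(ml:ℝ)) * ∑ k, lc (ff f (hh h (p.2 k).1)) (p.2 k).2 ≤
                  (1/(ml:ℝ)) * ∑ k, lc (ff f' (hh h' (p.2 k).1)) (p.2 k).2) →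
              (∫ q, lc (ff f (hh h q.1)) q.2 ∂D) ≤
                (∫ q, lc (ff fs (hh hs q.1)) q.2 ∂D) + ε₁} := by
  refine ⟨1280, by norm_num, ?_⟩
  intro X Y Φ H F G _ _ _ _ _ _ _ _ _ D _ DX _ _ hh ff lc Lr _ hlcm hLrm hlc hLr
    εc εr _ _ hs fs gs _ hrs ε₀ ε₁ δ hε₀ hε₁ hδ dGH dFH hdGH hdFH mu ml hmu hml hmu' hml'
  have hLrI : ∀ h g x, 0 ≤ Lr h g x := by
    intro h g x
    rcases hLr h g x with h0 | h0 <;> simp [h0]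
  set emp : (Fin mu → X) → H → ℝ := fun u h => ⨅ g : G, 1 / (mu : ℝ) * ∑ k, Lr h g (u k)
  set risk : H → ℝ := fun h => ⨅ g : G, ∫ x, Lr h g x ∂DX
  have hempBdd : ∀ (u : Fin mu → X) h,
      BddBelow (Set.range fun g : G => 1 / (mu : ℝ) * ∑ k, Lr h g (u k)) :=
    fun u h => ⟨0, by
      rintro _ ⟨g, rfl⟩
      exact mul_nonneg (by positivity) (Finset.sum_nonneg fun k _ => hLrI h g (u k))⟩
  have hriskBdd : ∀ h, BddBelow (Set.range fun g : G => ∫ x, Lr h g x ∂DX) :=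
    fun h => ⟨0, by
      rintro _ ⟨g, rfl⟩
      exact integral_nonneg fun x => hLrI h g x⟩
  have hrisks : risk hs ≤ εr := (ciInf_le (hriskBdd hs) gs).trans hrs
  -- the event controlling the regularization loss
  obtain ⟨EU, hEU, hEU'⟩ := exists_uniform_convergence_event DX (ι := H × G)
    (φ := fun i => Lr i.1 i.2) (fun i => hLr i.1 i.2) (fun i => hLrm i.1 i.2) (d := dGH)
    (le_of_eq (by
      rw [← hdGH]
      congr 1
      ext s
      simp [eq_comm])) hmu hε₀ hδ (le_trans (by
        have hδlog : 0 ≤ Real.log (1 / δ) := Real.log_nonneg (by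
          rw [le_div_iff₀ hδ.1]
          linarith [hδ.2])
        have hεlog : 0 ≤ Real.log (1 / ε₀) := Real.log_nonneg (by
          rw [le_div_iff₀ hε₀.1]
          linarith [hε₀.2])
        gcongr
        norm_num) hmu')
  have hU : ∀ u ∈ EU, ∀ h, emp u h ≤ εr + ε₀ → risk h ≤ εr + 2 * ε₀ ∧ emp u hs ≤ εr + ε₀ := by
    intro u hu h hle
    rcases hEU' u hu with heq | hdev
    · have hLeq : ∀ g, Lr h g = Lr hs g := fun g => heq (h, g) (hs, g)
      have h1 : risk h = risk hs := by simp only [risk, hLeq]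
      have h2 : emp u h = emp u hs := by simp only [emp, hLeq]
      exact ⟨by linarith [hε₀.1], h2 ▸ hle⟩
    · constructor
      · have : risk h - ε₀ ≤ emp u h := le_ciInf fun g => by
          have h1 := (abs_le.1 (hdev (h, g))).1
          have h2 : risk h ≤ ∫ x, Lr h g x ∂DX := ciInf_le (hriskBdd h) g
          dsimp only at h1
          linarith
        linarith
      · have h1 := (abs_le.1 (hdev (hs, gs))).2
        have h2 : emp u hs ≤ 1 / (mu : ℝ) * ∑ k, Lr hs gs (u k) := ciInf_le (hempBdd u hs) gs
        dsimp only at h1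
        linarith
  -- the event controlling the prediction loss on the restricted class
  obtain ⟨ES, hES, hES'⟩ := exists_uniform_convergence_event D
    (ι := {p : F × H // risk p.2 ≤ εr + 2 * ε₀})
    (φ := fun i q => lc (ff i.1.1 (hh i.1.2 q.1)) q.2) (fun _ _ => hlc _ _)
    (fun i => hlcm i.1.1 i.1.2) (d := dFH)
    (le_of_eq (by
      rw [← hdFH]
      congr 1
      ext s
      constructor
      · rintro ⟨⟨⟨f, h⟩, hle⟩, rfl⟩
        exact ⟨f, h, hle, rfl⟩
      · rintro ⟨f, h, hle, rfl⟩
        exact ⟨⟨⟨f, h⟩, hle⟩, rfl⟩)) hml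
    (ε := ε₁ / 2) ⟨by linarith [hε₁.1], by linarith [hε₁.1, hε₁.2]⟩ hδ
    (sample_size_half hε₁ hδ hml')
  calc ENNReal.ofReal (1 - δ)
      ≤ ENNReal.ofReal (1 - δ / 2) * ENNReal.ofReal (1 - δ / 2) := by
        rw [← ENNReal.ofReal_mul (by linarith [hδ.2])]
        exact ENNReal.ofReal_le_ofReal (by nlinarith [sq_nonneg δ])
    _ ≤ (Measure.pi fun _ : Fin mu => DX) EU * (Measure.pi fun _ : Fin ml => D) ES := by gcongr
    _ = ((Measure.pi fun _ : Fin mu => DX).prod (Measure.pi fun _ : Fin ml => D)) (EU ×ˢ ES) :=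
        (Measure.prod_prod _ _).symm
    _ ≤ _ := measure_mono ?_
  rintro ⟨u, z⟩ ⟨hu, hz⟩ f h hle hmin
  obtain ⟨hrisk, hemps⟩ := hU u hu h hle
  have hERM := hmin fs hs hemps
  have hfs : risk hs ≤ εr + 2 * ε₀ := by linarith [hε₀.1]
  rcases hES' z hz with heq | hdev
  · have h1 := heq ⟨(f, h), hrisk⟩ ⟨(fs, hs), hfs⟩
    dsimp only at h1
    rw [h1]
    linarith [hε₁.1]
  · have h1 := (abs_le.1 (hdev ⟨(f, h), hrisk⟩)).1
    have h2 := (abs_le.1 (hdev ⟨(fs, hs), hfs⟩)).2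
    dsimp only at h1 h2 hERM
    linarith
end

section
/- Let Σ ∈ ℝ^{d×d} be a symmetric positive semidefinite matrix with eigenvalues λ₁ ≥ λ₂ ≥ … ≥ λ_d listed with multiplicity, and let r be an integer with 0 ≤ r ≤ d. Then for every matrix P ∈ ℝ^{d×d} of rank at most r, trace((I − P)ᵀ (I − P) Σ) ≥ λ_{r+1} + λ_{r+2} + … + λ_d. -/
open Matrix

theorem OrthonormalBasis.sum_norm_sq_starProjection {ι E : Type*} [Fintype ι]
    [NormedAddCommGroup E] [InnerProductSpace ℝ E] [FiniteDimensional ℝ E]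
    (b : OrthonormalBasis ι ℝ E) (W : Submodule ℝ E) :
    ∑ i, ‖W.starProjection (b i)‖ ^ 2 = Module.finrank ℝ W := by
  have key (i : ι) : ‖W.starProjection (b i)‖ ^ 2
      = ∑ l, ‖inner ℝ (b i) (stdOrthonormalBasis ℝ W l : E)‖ ^ 2 := by
    rw [Submodule.starProjection_apply, Submodule.norm_coe,
      ← (stdOrthonormalBasis ℝ W).sum_sq_norm_inner_right]
    refine Finset.sum_congr rfl fun l _ => ?_
    rw [Submodule.inner_orthogonalProjectionOnto_eq_of_mem_left, real_inner_comm]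
  simp_rw [key]
  rw [Finset.sum_comm]
  simp_rw [b.sum_sq_norm_inner_right, Submodule.norm_coe, OrthonormalBasis.norm_eq_one]
  simp

/-- Weights in `[0, 1]` of total mass at least `d - r` cannot do better than to select the `d - r`
smallest values. -/
theorem sum_tail_le_sum_mul {d : ℕ} {lam c : Fin d → ℝ} (hmono : Antitone lam)
    (hpos : ∀ i, 0 ≤ lam i) {r : ℕ} (hr : r ≤ d) (hc0 : ∀ i, 0 ≤ c i) (hc1 : ∀ i, c i ≤ 1)
    (hc : (d : ℝ) - r ≤ ∑ i, c i) :
    ∑ i ∈ Finset.univ.filter (fun i : Fin d => r ≤ (i : ℕ)), lam i ≤ ∑ i, lam i * c i := by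
  obtain rfl | hlt := hr.eq_or_lt
  · have hempty : Finset.univ.filter (fun i : Fin r => r ≤ (i : ℕ)) = ∅ := by
      ext i
      simp [i.2]
    rw [hempty, Finset.sum_empty]
    exact Finset.sum_nonneg fun i _ => mul_nonneg (hpos i) (hc0 i)
  · set m : ℝ := lam ⟨r, hlt⟩
    have hm : 0 ≤ m := hpos _
    have hcard : ∑ i : Fin d, (if r ≤ (i : ℕ) then (1 : ℝ) else 0) = (d : ℝ) - r := by
      rw [Fin.sum_univ_eq_sum_range (fun i => if r ≤ i then (1 : ℝ) else 0) d,
        ← Finset.sum_filter, Finset.sum_const, nsmul_one, ← Nat.cast_sub hr]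
      congr 1
      rw [← Nat.card_Ico r d]
      congr 1
      ext i
      simp [and_comm]
    have hterm (i : Fin d) : m * (c i - if r ≤ (i : ℕ) then 1 else 0)
        ≤ lam i * c i - if r ≤ (i : ℕ) then lam i else 0 := by
      split_ifs with h
      · have : lam i ≤ m := hmono (Fin.mk_le_of_le_val h)
        nlinarith [hc1 i]
      · have : m ≤ lam i := hmono (Fin.le_def.mpr (by simp; omega))
        nlinarith [hc0 i]
    have hsum := Finset.sum_le_sum fun i (_ : i ∈ Finset.univ) => hterm i
    rw [← Finset.mul_sum, Finset.sum_sub_distrib, Finset.sum_sub_distrib, hcard] at hsum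
    rw [Finset.sum_filter]
    nlinarith [mul_nonneg hm (sub_nonneg.mpr hc)]

theorem OrthonormalBasis.sum_tail_le_sum_mul_norm_sq_sub {d : ℕ} {E : Type*}
    [NormedAddCommGroup E] [InnerProductSpace ℝ E] [FiniteDimensional ℝ E]
    (b : OrthonormalBasis (Fin d) ℝ E) {lam : Fin d → ℝ} (hmono : Antitone lam)
    (hpos : ∀ i, 0 ≤ lam i) {r : ℕ} (hr : r ≤ d) (T : E →ₗ[ℝ] E)
    (hT : Module.finrank ℝ (LinearMap.range T) ≤ r) :
    ∑ i ∈ Finset.univ.filter (fun i : Fin d => r ≤ (i : ℕ)), lam i ≤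
      ∑ i, lam i * ‖b i - T (b i)‖ ^ 2 := by
  set W := (LinearMap.range T)ᗮ
  refine (sum_tail_le_sum_mul (c := fun i => ‖W.starProjection (b i)‖ ^ 2) hmono hpos hr
    (fun i => sq_nonneg _) (fun i => ?_) ?_).trans
    (Finset.sum_le_sum fun i _ => mul_le_mul_of_nonneg_left ?_ (hpos i))
  · have := W.norm_starProjection_apply_le (b i)
    rw [b.norm_eq_one] at this
    exact pow_le_one₀ (norm_nonneg _) this
  · rw [b.sum_norm_sq_starProjection]
    have hdim : Module.finrank ℝ (LinearMap.range T) + Module.finrank ℝ W = Module.finrank ℝ E :=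
      (LinearMap.range T).finrank_add_finrank_orthogonal
    rw [Module.finrank_eq_card_basis b.toBasis, Fintype.card_fin] at hdim
    have : d ≤ Module.finrank ℝ W + r := by omega
    have : (d : ℝ) ≤ Module.finrank ℝ W + r := mod_cast this
    linarith
  · have hproj : W.starProjection (T (b i)) = 0 := by
      rw [Submodule.starProjection_apply_eq_zero_iff]
      exact Submodule.le_orthogonal_orthogonal _ (LinearMap.mem_range_self T (b i))
    have := W.norm_starProjection_apply_le (b i - T (b i))
    rw [map_sub, hproj, sub_zero] at this
    exact pow_le_pow_left₀ (norm_nonneg _) this 2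

theorem Matrix.trace_transpose_mul_self_mul_diagonal {n : Type*} [Fintype n] [DecidableEq n]
    (A : Matrix n n ℝ) (lam : n → ℝ) :
    trace (Aᵀ * A * diagonal lam) = ∑ i, lam i * ∑ j, A j i ^ 2 := by
  simp only [trace, diag_apply, mul_diagonal]
  refine Finset.sum_congr rfl fun i _ => ?_
  rw [mul_comm, mul_apply]
  simp [sq]

theorem stmt_10 {d : ℕ} (S : Matrix (Fin d) (Fin d) ℝ) (lam : Fin d → ℝ)
    (B : Matrix (Fin d) (Fin d) ℝ)
    (hB : Bᵀ * B = 1)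
    (hdiag : S = B * Matrix.diagonal lam * Bᵀ)
    (hmono : ∀ i j : Fin d, i ≤ j → lam j ≤ lam i)
    (hpos : ∀ i, 0 ≤ lam i)
    (r : ℕ) (hr : r ≤ d)
    (P : Matrix (Fin d) (Fin d) ℝ) (hP : P.rank ≤ r) :
    ∑ i ∈ Finset.univ.filter (fun i : Fin d => r ≤ (i : ℕ)), lam i ≤
      Matrix.trace (((1 - P)ᵀ * (1 - P)) * S) := by
  have hB' : B * Bᵀ = 1 := mul_eq_one_comm.mp hB
  set Q := Bᵀ * P * B
  have hQrank : Q.rank ≤ r :=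
    ((rank_mul_le_left _ _).trans (rank_mul_le_right _ _)).trans hP
  have hQsub : 1 - Q = Bᵀ * (1 - P) * B := by
    rw [Matrix.mul_sub, Matrix.sub_mul, Matrix.mul_one, hB]
  have htrace : trace ((1 - P)ᵀ * (1 - P) * S) = trace ((1 - Q)ᵀ * (1 - Q) * diagonal lam) := by
    have hconj : (1 - Q)ᵀ * (1 - Q) = Bᵀ * ((1 - P)ᵀ * (1 - P)) * B := by
      rw [hQsub, transpose_mul, transpose_mul, transpose_transpose]
      calc _ = Bᵀ * ((1 - P)ᵀ * (B * Bᵀ) * (1 - P)) * B := by simp only [Matrix.mul_assoc]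
        _ = _ := by rw [hB', Matrix.mul_one]
    rw [hconj, hdiag, ← Matrix.mul_assoc, trace_mul_comm]
    simp only [Matrix.mul_assoc]
  rw [htrace, trace_transpose_mul_self_mul_diagonal]
  have hrange : Module.finrank ℝ (LinearMap.range (toEuclideanLin Q)) ≤ r := by
    rw [toEuclideanLin_eq_toLin_orthonormal, ← rank_eq_finrank_range_toLin]
    exact hQrank
  refine ((EuclideanSpace.basisFun (Fin d) ℝ).sum_tail_le_sum_mul_norm_sq_sub
    hmono hpos hr _ hrange).trans_eq (Finset.sum_congr rfl fun i _ => ?_)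
  rw [EuclideanSpace.real_norm_sq_eq]
  congr 1
  refine Finset.sum_congr rfl fun j _ => ?_
  simp [Matrix.one_apply]
end

section
/- Let d, r be positive integers with r ≤ d, let B ∈ ℝ^{d×d} satisfy BᵀB = I_d, and let S, S' ⊆ {1, …, d} be subsets with |S| = |S'| = r and S ≠ S'. Let B_S, B_{S'} ∈ ℝ^{d×r} denote the submatrices of B consisting of the columns indexed by S and by S' (in increasing order of index). Then for all O, O' ∈ ℝ^{r×r} with OᵀO = I_r and O'ᵀO' = I_r, the squared Frobenius distance satisfies ‖O B_Sᵀ − O' B_{S'}ᵀ‖_F² ≥ 2. -/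
open Matrix

/-- Right multiplication by an orthogonal matrix preserves the sum of squares of the entries. -/
theorem sum_sq_mul_orthogonal {m n : Type*} [Fintype m] [Fintype n] [DecidableEq n]
    (M : Matrix m n ℝ) {B : Matrix n n ℝ} (hB : Bᵀ * B = 1) :
    ∑ i, ∑ j, (M * B) i j ^ 2 = ∑ i, ∑ j, M i j ^ 2 := by
  have hB' : B * Bᵀ = 1 := mul_eq_one_comm.mp hB
  have h : (M * B) * (M * B)ᵀ = M * Mᵀ := by
    rw [transpose_mul, Matrix.mul_assoc, ← Matrix.mul_assoc B, hB', Matrix.one_mul]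
  refine Finset.sum_congr rfl fun i _ => ?_
  have hi := congrFun (congrFun h i) i
  simpa only [mul_apply, transpose_apply, ← pow_two] using hi

/-- Each column of a matrix with orthonormal columns has unit length. -/
theorem sum_sq_col_eq_one {m p : Type*} [Fintype m] [DecidableEq p]
    {O : Matrix m p ℝ} (hO : Oᵀ * O = 1) (k : p) :
    ∑ i, O i k ^ 2 = 1 := by
  have h := congrFun (congrFun hO k) k
  simpa only [mul_apply, transpose_apply, ← pow_two, one_apply_eq] using h

theorem mul_transpose_columns_mul_apply {m n p : Type*} [Fintype n] [Fintype p] [DecidableEq n]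
    (O : Matrix m p ℝ) {B : Matrix n n ℝ}
    (hB : Bᵀ * B = 1) (s : p → n) (i : m) (l : n) :
    (O * (Matrix.of fun a k => B a (s k))ᵀ * B) i l = ∑ k, if s k = l then O i k else 0 := by
  rw [Matrix.mul_assoc, mul_apply]
  refine Finset.sum_congr rfl fun k _ => ?_
  have h := congrFun (congrFun hB (s k)) l
  simp only [mul_apply, transpose_apply, one_apply] at h
  simp only [mul_apply, transpose_apply, of_apply, h, mul_ite, mul_one, mul_zero]

/-- A column of `B` chosen by `s` but not by `t` contributes unit mass to the difference. -/
theorem sum_sq_sub_mul_col_eq_one {m n p q : Type*} [Fintype m] [Fintype n] [Fintype p]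
    [Fintype q] [DecidableEq n] [DecidableEq p]
    {O : Matrix m p ℝ} (hO : Oᵀ * O = 1) (O' : Matrix m q ℝ)
    {B : Matrix n n ℝ} (hB : Bᵀ * B = 1) {s : p → n} (hs : Function.Injective s)
    {t : q → n} (k : p) (hk : ∀ j, t j ≠ s k) :
    ∑ i, ((O * (Matrix.of fun a k => B a (s k))ᵀ -
      O' * (Matrix.of fun a k => B a (t k))ᵀ) * B) i (s k) ^ 2 = 1 := by
  rw [← sum_sq_col_eq_one hO k]
  refine Finset.sum_congr rfl fun i _ => ?_
  rw [Matrix.sub_mul, Matrix.sub_apply, mul_transpose_columns_mul_apply O hB,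
    mul_transpose_columns_mul_apply O' hB]
  simp [hk, hs.eq_iff]

theorem stmt_11 {d r : ℕ} (hr0 : 0 < r) (hrd : r ≤ d)
    (B : Matrix (Fin d) (Fin d) ℝ) (hB : Bᵀ * B = 1)
    (S S' : Finset (Fin d)) (hS : S.card = r) (hS' : S'.card = r) (hne : S ≠ S')
    (O O' : Matrix (Fin r) (Fin r) ℝ) (hO : Oᵀ * O = 1) (hO' : O'ᵀ * O' = 1) :
    2 ≤ ∑ i : Fin r, ∑ j : Fin d,
      ((O * (Matrix.of fun (a : Fin d) (k : Fin r) => B a ((S.orderIsoOfFin hS k : Fin d)))ᵀ) i j -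
       (O' * (Matrix.of fun (a : Fin d) (k : Fin r) => B a ((S'.orderIsoOfFin hS' k : Fin d)))ᵀ) i j)^2 := by
  obtain ⟨x, hxS, hxS'⟩ : ∃ x ∈ S, x ∉ S' :=
    Finset.not_subset.mp fun h => hne (Finset.eq_of_subset_of_card_le h (by omega))
  obtain ⟨y, hyS', hyS⟩ : ∃ y ∈ S', y ∉ S :=
    Finset.not_subset.mp fun h => hne (Finset.eq_of_subset_of_card_le h (by omega)).symm
  have hxy : x ≠ y := fun h => hyS (h ▸ hxS)
  set s : Fin r → Fin d := fun k => S.orderIsoOfFin hS k with hs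
  set t : Fin r → Fin d := fun k => S'.orderIsoOfFin hS' k with ht
  have hs_inj : Function.Injective s :=
    Subtype.val_injective.comp (S.orderIsoOfFin hS).injective
  have ht_inj : Function.Injective t :=
    Subtype.val_injective.comp (S'.orderIsoOfFin hS').injective
  obtain ⟨k, hk⟩ : ∃ k, s k = x := ⟨(S.orderIsoOfFin hS).symm ⟨x, hxS⟩, by simp only [hs, OrderIso.apply_symm_apply]⟩
  obtain ⟨l, hl⟩ : ∃ l, t l = y := ⟨(S'.orderIsoOfFin hS').symm ⟨y, hyS'⟩, by simp only [ht, OrderIso.apply_symm_apply]⟩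
  have hx := sum_sq_sub_mul_col_eq_one hO O' hB hs_inj (t := t) k fun j h =>
    hxS' (hk ▸ h ▸ (S'.orderIsoOfFin hS' j).2)
  have hy := sum_sq_sub_mul_col_eq_one hO' O hB ht_inj (t := s) l fun j h =>
    hyS (hl ▸ h ▸ (S.orderIsoOfFin hS j).2)
  rw [hk] at hx
  rw [hl, ← neg_sub, Matrix.neg_mul] at hy
  simp only [Matrix.neg_apply, neg_sq] at hy
  change 2 ≤ ∑ i, ∑ j, (O * (Matrix.of fun a k => B a (s k))ᵀ -
    O' * (Matrix.of fun a k => B a (t k))ᵀ) i j ^ 2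
  rw [← sum_sq_mul_orthogonal _ hB, Finset.sum_comm]
  calc (2 : ℝ) = ∑ j ∈ {x, y}, ∑ i, ((O * (Matrix.of fun a k => B a (s k))ᵀ -
        O' * (Matrix.of fun a k => B a (t k))ᵀ) * B) i j ^ 2 := by
        rw [Finset.sum_pair hxy, hx, hy]; norm_num
    _ ≤ _ := Finset.sum_le_sum_of_subset_of_nonneg (Finset.subset_univ _)
        fun _ _ _ => Finset.sum_nonneg fun _ _ => sq_nonneg _
end

section
/- Let d, r be positive integers with 2r < d, let B ∈ ℝ^{d×d} be an orthogonal matrix (BᵀB = I_d), and let B_{1:r} ∈ ℝ^{d×r} consist of the first r columns of B. Let 𝓗 = {W ∈ ℝ^{r×d} : every row of W has ℓ₂-norm at most 1} and 𝓗₀ = {O B_{1:r}ᵀ : O ∈ ℝ^{r×r}, OᵀO = I_r}. Then for every ρ ∈ (0, 1/2), N_𝓗(ρ) ≥ binom(d − r, r) · N_{𝓗₀}(ρ), where covers are taken with respect to the Frobenius distance on ℝ^{r×d}. -/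
open Matrix

/-- Frobenius distance between two real matrices. -/
noncomputable def frobDist {m n : ℕ} (A B : Matrix (Fin m) (Fin n) ℝ) : ℝ :=
  Real.sqrt (∑ i, ∑ j, (A i j - B i j)^2)

/-- Minimal cardinality of a `ρ`-cover of `A` w.r.t. the Frobenius distance,
`∞` if no finite cover exists. -/
noncomputable def coverNum {m n : ℕ} (A : Set (Matrix (Fin m) (Fin n) ℝ)) (ρ : ℝ) : ℕ∞ :=
  sInf ((fun C : Finset (Matrix (Fin m) (Fin n) ℝ) => (C.card : ℕ∞)) ''
    {C | ∀ W ∈ A, ∃ W' ∈ C, frobDist W W' ≤ ρ})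

attribute [local instance] Matrix.frobeniusNormedAddCommGroup in
theorem frobDist_eq_dist {m n : ℕ} (A B : Matrix (Fin m) (Fin n) ℝ) :
    frobDist A B = dist A B := by
  rw [dist_eq_norm, Matrix.frobenius_norm_def, frobDist, Real.sqrt_eq_rpow]
  simp

attribute [local instance] Matrix.frobeniusNormedAddCommGroup in
theorem frobDist_triangle_right {m n : ℕ} (A B C : Matrix (Fin m) (Fin n) ℝ) :
    frobDist A B ≤ frobDist A C + frobDist B C := by
  simp only [frobDist_eq_dist]
  exact dist_triangle_right A B C

theorem sum_sq_row_eq_mul_transpose {m n : ℕ} (A : Matrix (Fin m) (Fin n) ℝ) (i : Fin m) :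
    ∑ j, A i j ^ 2 = (A * Aᵀ) i i := by
  simp [Matrix.mul_apply, sq]

theorem sum_sq_row_mul_orthogonal {m n : ℕ} (A : Matrix (Fin m) (Fin n) ℝ)
    {Q : Matrix (Fin n) (Fin n) ℝ} (hQ : Q * Qᵀ = 1) (i : Fin m) :
    ∑ j, (A * Q) i j ^ 2 = ∑ j, A i j ^ 2 := by
  rw [sum_sq_row_eq_mul_transpose, sum_sq_row_eq_mul_transpose, Matrix.transpose_mul,
    Matrix.mul_assoc, ← Matrix.mul_assoc Q, hQ, Matrix.one_mul]

theorem frobDist_mul_orthogonal {m n : ℕ} (A A' : Matrix (Fin m) (Fin n) ℝ)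
    {Q : Matrix (Fin n) (Fin n) ℝ} (hQ : Q * Qᵀ = 1) :
    frobDist (A * Q) (A' * Q) = frobDist A A' := by
  unfold frobDist
  simp_rw [← Matrix.sub_apply, ← Matrix.sub_mul, sum_sq_row_mul_orthogonal _ hQ]

/-- A column in which one matrix vanishes and the other has unit norm forces distance at least
one. -/
theorem one_le_frobDist_of_column {m n : ℕ} {A A' : Matrix (Fin m) (Fin n) ℝ} (j : Fin n)
    (h : ∑ i, A i j ^ 2 = 1) (h' : ∀ i, A' i j = 0) : 1 ≤ frobDist A A' := by
  unfold frobDist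
  rw [Real.one_le_sqrt, ← h]
  refine Finset.sum_le_sum fun i _ => ?_
  calc A i j ^ 2 = (A i j - A' i j) ^ 2 := by rw [h' i, sub_zero]
    _ ≤ ∑ k, (A i k - A' i k) ^ 2 :=
      Finset.single_le_sum (f := fun k => (A i k - A' i k) ^ 2) (fun _ _ => sq_nonneg _)
        (Finset.mem_univ j)

theorem coverNum_le_card {m n : ℕ} {A : Set (Matrix (Fin m) (Fin n) ℝ)} {ρ : ℝ}
    {C : Finset (Matrix (Fin m) (Fin n) ℝ)} (hC : ∀ W ∈ A, ∃ W' ∈ C, frobDist W W' ≤ ρ) :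
    coverNum A ρ ≤ C.card :=
  sInf_le ⟨C, hC, rfl⟩

/-- If a set contains the images of `A` under a family of orthogonal maps, and these images are
pairwise more than `2 * ρ` apart, then its covering number is at least the size of the family
times the covering number of `A`. -/
theorem card_mul_coverNum_le {ι : Type*} {m n : ℕ} {A H : Set (Matrix (Fin m) (Fin n) ℝ)} {ρ : ℝ}
    (s : Finset ι) (Q : ι → Matrix (Fin n) (Fin n) ℝ)
    (hQ : ∀ a ∈ s, Q a * (Q a)ᵀ = 1) (hH : ∀ a ∈ s, ∀ W ∈ A, W * Q a ∈ H)
    (hsep : ∀ a ∈ s, ∀ b ∈ s, a ≠ b → ∀ W ∈ A, ∀ W' ∈ A,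
      2 * ρ < frobDist (W * Q a) (W' * Q b)) :
    (s.card : ℕ∞) * coverNum A ρ ≤ coverNum H ρ := by
  classical
  refine le_sInf ?_
  rintro _ ⟨C, hC, rfl⟩
  let D : ι → Finset (Matrix (Fin m) (Fin n) ℝ) := fun a =>
    C.filter fun c => ∃ W ∈ A, frobDist (W * Q a) c ≤ ρ
  have hcover : ∀ a ∈ s, coverNum A ρ ≤ (D a).card := by
    intro a ha
    refine le_trans (coverNum_le_card (C := (D a).image (· * (Q a)ᵀ)) ?_)
      (by exact_mod_cast Finset.card_image_le)
    intro W hW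
    obtain ⟨c, hc, hWc⟩ := hC _ (hH a ha W hW)
    refine ⟨c * (Q a)ᵀ,
      Finset.mem_image_of_mem _ (Finset.mem_filter.mpr ⟨hc, W, hW, hWc⟩), ?_⟩
    rwa [← frobDist_mul_orthogonal _ _ (hQ a ha), Matrix.mul_assoc c,
      mul_eq_one_comm.mp (hQ a ha), Matrix.mul_one]
  have hdisj : (s : Set ι).PairwiseDisjoint D := by
    intro a ha b hb hab
    refine Finset.disjoint_left.mpr fun c hca hcb => ?_
    obtain ⟨-, W, hW, h⟩ := Finset.mem_filter.mp hca
    obtain ⟨-, W', hW', h'⟩ := Finset.mem_filter.mp hcb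
    have := hsep a ha b hb hab W hW W' hW'
    have := frobDist_triangle_right (W * Q a) (W' * Q b) c
    linarith
  calc (s.card : ℕ∞) * coverNum A ρ = ∑ _a ∈ s, coverNum A ρ := by simp
    _ ≤ ∑ a ∈ s, ((D a).card : ℕ∞) := Finset.sum_le_sum hcover
    _ = ((s.biUnion D).card : ℕ∞) := by rw [Finset.card_biUnion hdisj]; simp
    _ ≤ (C.card : ℕ∞) := by
      exact_mod_cast Finset.card_le_card
        (Finset.biUnion_subset.mpr fun a _ => Finset.filter_subset _ _)

theorem exists_perm_lt_iff_mem {d r : ℕ} (hrd : r ≤ d) (S : Finset (Fin d)) (hS : S.card = r) :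
    ∃ σ : Equiv.Perm (Fin d), ∀ j, (σ j : ℕ) < r ↔ j ∈ S := by
  classical
  have hcard : Fintype.card {j // j ∈ S} = Fintype.card {j : Fin d // (j : ℕ) < r} := by
    rw [Fintype.card_coe, hS, Fintype.card_congr (Fin.castLEquiv hrd).symm, Fintype.card_fin]
  let e := Fintype.equivOfCardEq hcard
  refine ⟨e.extendSubtype, fun j => ⟨fun h => ?_, fun h => e.extendSubtype_mem j h⟩⟩
  by_contra hj
  exact e.extendSubtype_not_mem j hj h

theorem stmt_13 {d r : ℕ} (hr0 : 0 < r) (hrd : 2 * r < d)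
    (B : Matrix (Fin d) (Fin d) ℝ) (hB : Bᵀ * B = 1) :
    ∀ ρ ∈ Set.Ioo (0:ℝ) (1/2),
      (Nat.choose (d - r) r : ℕ∞) *
        coverNum {W : Matrix (Fin r) (Fin d) ℝ |
          ∃ O : Matrix (Fin r) (Fin r) ℝ, Oᵀ * O = 1 ∧
            W = O * (Matrix.of fun (a : Fin d) (k : Fin r) =>
              B a (Fin.castLE (by omega) k))ᵀ} ρ ≤
      coverNum {W : Matrix (Fin r) (Fin d) ℝ | ∀ i, ∑ j, (W i j)^2 ≤ 1} ρ := by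
  rintro ρ ⟨-, hρ⟩
  have hle : r ≤ d := by omega
  have hB' : B * Bᵀ = 1 := mul_eq_one_comm.mp hB
  have hEB : (Matrix.of fun (a : Fin d) (k : Fin r) => B a (Fin.castLE hle k))ᵀ * B =
      (1 : Matrix (Fin d) (Fin d) ℝ).submatrix (Fin.castLE hle) id := by
    rw [← hB]; rfl
  have hex : ∀ S : Finset (Fin d), ∃ σ : Equiv.Perm (Fin d),
      S.card = r → ∀ j, (σ j : ℕ) < r ↔ j ∈ S := by
    intro S
    by_cases hS : S.card = r
    · obtain ⟨σ, hσ⟩ := exists_perm_lt_iff_mem hle S hS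
      exact ⟨σ, fun _ => hσ⟩
    · exact ⟨1, fun h => absurd h hS⟩
  choose σ hσ using hex
  let P : Finset (Fin d) → Matrix (Fin d) (Fin d) ℝ := fun S =>
    (1 : Matrix (Fin d) (Fin d) ℝ).submatrix id (σ S)
  have hP : ∀ S, P S * (P S)ᵀ = 1 := by
    intro S
    refine mul_eq_one_comm.mp ?_
    simp only [P, Matrix.transpose_submatrix, Matrix.transpose_one]
    rw [← Matrix.submatrix_mul _ _ _ id _ Function.bijective_id]
    simp
  let Q : Finset (Fin d) → Matrix (Fin d) (Fin d) ℝ := fun S => B * P S * Bᵀ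
  have hQ : ∀ S, Q S * (Q S)ᵀ = 1 := by
    intro S
    calc Q S * (Q S)ᵀ = B * (P S * (Bᵀ * B) * (P S)ᵀ) * Bᵀ := by
          simp only [Q, Matrix.transpose_mul, Matrix.transpose_transpose, Matrix.mul_assoc]
      _ = 1 := by rw [hB, Matrix.mul_one, hP, Matrix.mul_one, hB']
  have hentry : ∀ (O : Matrix (Fin r) (Fin r) ℝ) S i j,
      (O * (Matrix.of fun (a : Fin d) (k : Fin r) => B a (Fin.castLE hle k))ᵀ * Q S * B) i j =
        ∑ k, O i k * if Fin.castLE hle k = σ S j then 1 else 0 := by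
    intro O S i j
    have : O * (Matrix.of fun (a : Fin d) (k : Fin r) => B a (Fin.castLE hle k))ᵀ * Q S * B =
        O * (((Matrix.of fun (a : Fin d) (k : Fin r) => B a (Fin.castLE hle k))ᵀ * B) *
          P S * (Bᵀ * B)) := by
      simp only [Q, Matrix.mul_assoc]
    rw [this, hB, hEB, Matrix.mul_one]
    have h1 : (1 : Matrix (Fin d) (Fin d) ℝ).submatrix (Fin.castLE hle) id * P S =
        (1 : Matrix (Fin d) (Fin d) ℝ).submatrix (Fin.castLE hle) (σ S) := by
      simp only [P]
      rw [← Matrix.submatrix_mul _ _ _ id _ Function.bijective_id, Matrix.one_mul]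
    rw [h1, Matrix.mul_apply]
    simp [Matrix.one_apply]
  refine le_trans (mul_le_mul_left ?_ _)
    (card_mul_coverNum_le (Finset.univ.powersetCard r) Q (fun S _ => hQ S) ?_ ?_)
  · rw [Finset.card_powersetCard, Finset.card_univ, Fintype.card_fin]
    exact_mod_cast Nat.choose_le_choose r (Nat.sub_le d r)
  · rintro S - _ ⟨O, hO, rfl⟩ i
    rw [sum_sq_row_mul_orthogonal _ (hQ S), ← sum_sq_row_mul_orthogonal _ hB', Matrix.mul_assoc,
      hEB, sum_sq_row_eq_mul_transpose, Matrix.transpose_mul, Matrix.mul_assoc,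
      ← Matrix.mul_assoc _ _ Oᵀ, Matrix.transpose_submatrix, Matrix.transpose_one,
      ← Matrix.submatrix_mul _ _ _ id _ Function.bijective_id, Matrix.one_mul,
      Matrix.submatrix_one _ (Fin.castLE_injective hle), Matrix.one_mul,
      mul_eq_one_comm.mp hO, Matrix.one_apply_eq]
  · rintro S hS T hT hST _ ⟨O, hO, rfl⟩ _ ⟨O', -, rfl⟩
    have hS := (Finset.mem_powersetCard.mp hS).2
    have hT := (Finset.mem_powersetCard.mp hT).2
    obtain ⟨j, hjS, hjT⟩ := Finset.not_subset.mp fun h =>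
      hST (Finset.eq_of_subset_of_card_le h (hT.trans hS.symm).le)
    have hjr := (hσ S hS j).mpr hjS
    have hjr' : ¬ (σ T j : ℕ) < r := fun h => hjT ((hσ T hT j).mp h)
    refine lt_of_lt_of_le (by linarith : 2 * ρ < 1) ?_
    rw [← frobDist_mul_orthogonal _ _ hB']
    refine one_le_frobDist_of_column j ?_ ?_
    · have hk : ∀ k : Fin r, Fin.castLE hle k = σ S j ↔ k = ⟨σ S j, hjr⟩ := by
        intro k; simp [Fin.ext_iff]
      simp_rw [hentry, hk]
      simpa [Matrix.mul_apply, sq] using congrFun (congrFun hO ⟨σ S j, hjr⟩) ⟨σ S j, hjr⟩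
    · intro i
      rw [hentry]
      refine Finset.sum_eq_zero fun k _ => ?_
      rw [if_neg, mul_zero]
      intro h
      exact hjr' (by rw [← h]; exact k.2)
end
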